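/- arXiv:math/0607130 — 2 statements merged into one kernel-verified Lean document; each statement's English description precedes it below -/
import Mathlib

section
/- Let k be an algebraically closed field of characteristic different from 2. For every unit a of k((u)) satisfying a·ā = 1, there exists a unit b of k((u)) such that a = b̄ · b^{-1}. (Here ā denotes the Laurent series obtained from a by multiplying its n-th coefficient by (−1)^n.) -/
/-- The coefficientwise involution of `k((u))` induced by `u ↦ -u`:
it sends `Σ aₙ uⁿ` to `Σ (-1)ⁿ aₙ uⁿ`. -/
def LaurentSeries.uBar {k : Type*} [CommRing k] (f : LaurentSeries k) :
    LaurentSeries k where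
  coeff n := (((-1 : kˣ) ^ n : kˣ) : k) * f.coeff n
  isPWO_support' := f.isPWO_support'.mono (by
    intro n hn
    simp only [Function.mem_support] at hn ⊢
    intro h
    exact hn (by rw [h, mul_zero]))

namespace LaurentSeries

variable {k : Type*} [CommRing k]

theorem uBar_add (f g : LaurentSeries k) : uBar (f + g) = uBar f + uBar g := by
  ext n
  exact mul_add _ _ _

theorem uBar_uBar (f : LaurentSeries k) : uBar (uBar f) = f := by
  ext n
  change (((-1 : kˣ) ^ n : kˣ) : k) * ((((-1 : kˣ) ^ n : kˣ) : k) * f.coeff n) = f.coeff n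
  rw [← mul_assoc, ← Units.val_mul, ← mul_zpow]
  simp

theorem uBar_single (m : ℤ) (r : k) :
    uBar (HahnSeries.single m r) =
      HahnSeries.single m ((((-1 : kˣ) ^ m : kˣ) : k) * r) := by
  ext n
  change (((-1 : kˣ) ^ n : kˣ) : k) * (HahnSeries.single m r).coeff n = _
  by_cases hn : n = m
  · subst hn
    simp
  · simp [HahnSeries.coeff_single_of_ne hn]

theorem uBar_one : uBar (1 : LaurentSeries k) = 1 := by
  rw [← HahnSeries.single_zero_one, uBar_single, zpow_zero, Units.val_one, one_mul]

end LaurentSeries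

/-- Hilbert 90 for the norm-one torus.  Over an algebraically
closed field `k` of characteristic `≠ 2`, every unit `a` of `k((u))` with
`a · ā = 1` is of the form `a = b̄ · b⁻¹` for some unit `b` of `k((u))`. -/
theorem stmt5 (k : Type*) [Field k] [IsAlgClosed k] (hchar : (2 : k) ≠ 0)
    (a : (LaurentSeries k)ˣ)
    (h : (a : LaurentSeries k) * LaurentSeries.uBar (a : LaurentSeries k) = 1) :
    ∃ b : (LaurentSeries k)ˣ,
      (a : LaurentSeries k) =
        LaurentSeries.uBar (b : LaurentSeries k) * ((b⁻¹ : (LaurentSeries k)ˣ) : LaurentSeries k) := by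
  suffices H : ∃ b : LaurentSeries k, b ≠ 0 ∧ (a : LaurentSeries k) * b = LaurentSeries.uBar b by
    obtain ⟨b, hb, hab⟩ := H
    refine ⟨Units.mk0 b hb, ?_⟩
    rw [Units.eq_mul_inv_iff_mul_eq]
    exact hab
  by_cases ha : 1 + LaurentSeries.uBar (a : LaurentSeries k) = 0
  · have hbar : LaurentSeries.uBar (a : LaurentSeries k) = -1 := (neg_eq_of_add_eq_zero_right ha).symm
    have ha' : (a : LaurentSeries k) = -1 := by
      rw [hbar, mul_neg_one] at h
      exact neg_eq_iff_eq_neg.mp h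
    refine ⟨HahnSeries.single 1 1, HahnSeries.single_ne_zero one_ne_zero, ?_⟩
    rw [ha', LaurentSeries.uBar_single]
    simp
  · refine ⟨_, ha, ?_⟩
    rw [LaurentSeries.uBar_add, LaurentSeries.uBar_one, LaurentSeries.uBar_uBar, mul_add, h,
      mul_one, add_comm]
end

section
/- Let k be a field of characteristic different from 2, and let b, b' be units of k((u)) such that b̄ · b^{-1} = b̄' · b'^{-1}, where f̄ denotes the Laurent series obtained from f by multiplying its n-th coefficient by (−1)^n. Then ord(b) ≡ ord(b') modulo 2, where ord denotes the order of a nonzero Laurent series (the least integer n such that the coefficient at n is nonzero). Hence the sign (−1)^{ord(b)} attached to a norm-one element a = b̄·b^{-1} is independent of the choice of b (this defines the Kottwitz homomorphism for the norm-one torus of k((u))/k((t))). -/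
namespace LaurentSeries

theorem support_uBar {k : Type*} [CommRing k] (f : LaurentSeries k) :
    (uBar f).support = f.support := by
  ext n
  exact not_congr (((-1 : kˣ) ^ n).mul_right_eq_zero)

theorem uBar_ne_zero {k : Type*} [CommRing k] {f : LaurentSeries k} (hf : f ≠ 0) :
    uBar f ≠ 0 := by
  rwa [← HahnSeries.support_nonempty_iff, support_uBar, HahnSeries.support_nonempty_iff]

theorem order_uBar {k : Type*} [CommRing k] {f : LaurentSeries k} (hf : f ≠ 0) :
    (uBar f).order = f.order := by
  simp only [HahnSeries.order_of_ne hf, HahnSeries.order_of_ne (uBar_ne_zero hf), support_uBar]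

theorem leadingCoeff_uBar {k : Type*} [CommRing k] {f : LaurentSeries k} (hf : f ≠ 0) :
    (uBar f).leadingCoeff = (((-1 : kˣ) ^ f.order : kˣ) : k) * f.leadingCoeff := by
  rw [HahnSeries.leadingCoeff_eq, HahnSeries.leadingCoeff_eq, order_uBar hf]
  rfl

end LaurentSeries

theorem Int.modEq_two_of_neg_one_zpow_eq {k : Type*} [Field k] (hchar : (2 : k) ≠ 0) {m n : ℤ}
    (h : (-1 : kˣ) ^ m = (-1) ^ n) : m ≡ n [ZMOD 2] := by
  have hne : (-1 : kˣ) ≠ 1 := by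
    intro h1
    have h2 : (-1 : k) = 1 := by simpa using congrArg Units.val h1
    exact hchar (by linear_combination -h2)
  rcases Int.even_or_odd m with hm | hm <;> rcases Int.even_or_odd n with hn | hn
  · exact (Int.even_iff.mp hm).trans (Int.even_iff.mp hn).symm
  · rw [hm.neg_one_zpow, hn.neg_one_zpow] at h
    exact absurd h.symm hne
  · rw [hm.neg_one_zpow, hn.neg_one_zpow] at h
    exact absurd h hne
  · exact (Int.odd_iff.mp hm).trans (Int.odd_iff.mp hn).symm

/-- For a field `k` of characteristic `≠ 2` and units `b`,
`b'` of `k((u))` with `b̄ · b⁻¹ = b̄' · b'⁻¹`, one has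
`ord(b) ≡ ord(b') (mod 2)`; hence the sign `(-1)^{ord b}` attached to a
norm-one element `a = b̄·b⁻¹` is well defined (the Kottwitz homomorphism of
the norm-one torus of `k((u))/k((t))`). -/
theorem stmt6 (k : Type*) [Field k] (hchar : (2 : k) ≠ 0)
    (b b' : (LaurentSeries k)ˣ)
    (h : LaurentSeries.uBar (b : LaurentSeries k) *
          ((b⁻¹ : (LaurentSeries k)ˣ) : LaurentSeries k) =
         LaurentSeries.uBar (b' : LaurentSeries k) *
          ((b'⁻¹ : (LaurentSeries k)ˣ) : LaurentSeries k)) :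
    Int.ModEq 2 ((b : LaurentSeries k).order) ((b' : LaurentSeries k).order) := by
  have hmul : LaurentSeries.uBar (b : LaurentSeries k) * (b' : LaurentSeries k) =
      LaurentSeries.uBar (b' : LaurentSeries k) * (b : LaurentSeries k) := by
    rw [Units.mul_inv_eq_iff_eq_mul] at h
    rw [h, mul_right_comm, Units.inv_mul_cancel_right]
  have hlead := congrArg HahnSeries.leadingCoeff hmul
  rw [HahnSeries.leadingCoeff_mul, HahnSeries.leadingCoeff_mul,
    LaurentSeries.leadingCoeff_uBar b.ne_zero, LaurentSeries.leadingCoeff_uBar b'.ne_zero,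
    mul_assoc, mul_assoc, mul_comm (b' : LaurentSeries k).leadingCoeff] at hlead
  have hne : (b : LaurentSeries k).leadingCoeff * (b' : LaurentSeries k).leadingCoeff ≠ 0 :=
    mul_ne_zero (HahnSeries.leadingCoeff_ne_zero.mpr b.ne_zero)
      (HahnSeries.leadingCoeff_ne_zero.mpr b'.ne_zero)
  exact Int.modEq_two_of_neg_one_zpow_eq hchar (Units.ext (mul_right_cancel₀ hne hlead))
end
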